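/- arXiv:1702.01985 — 7 statements merged into one kernel-verified Lean document; each statement's English description precedes it below -/
import Mathlib

section
/- The set of integers j for which there exists a nonzero rational number t with j = (t+16)³/t is exactly {−3³·5³, −2²·7³, −2⁴·3³, −2⁶, 0, 2⁷, 2⁶·3³, 2⁴·5³, 2¹¹, 2²·3⁶, 2⁷·3³, 17³, 2⁶·5³, 2⁵·7³, 2⁵·3⁶, 2⁴·3³·5³, 2⁴·17³, 2³·31³, 2³·3³·11³, 2²·3⁶·7³, 2²·5³·13³, 2·127³, 2·3³·43³, 3³·5³·17³, 257³}. -/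
open Polynomial in
/-- A rational number at which `(t + 16) ^ 3 / t` takes an integral value is an integer. -/
theorem exists_int_eq_of_add_pow_three_eq_mul {j : ℤ} {t : ℚ} (h : (t + 16) ^ 3 = j * t) :
    ∃ n : ℤ, (n : ℚ) = t := by
  have hint : IsIntegral ℤ t := by
    refine ⟨X ^ 3 + (C 48 * X ^ 2 + C (768 - j) * X + C 4096), ?_, ?_⟩
    · refine monic_X_pow_add (lt_of_le_of_lt (b := 2) ?_ (by norm_num))
      compute_degree
    · simp only [eval₂_add, eval₂_mul, eval₂_X_pow, eval₂_C, eval₂_X]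
      simp only [eq_intCast]
      push_cast
      linear_combination h
  obtain ⟨n, hn⟩ := IsIntegrallyClosed.isIntegral_iff.mp hint
  exact ⟨n, by simpa using hn⟩

/-- An integer `n` with `n ∣ (n + 16) ^ 3` is a signed power of two dividing `2 ^ 12`. -/
theorem exists_eq_or_eq_neg_two_pow_of_add_pow_three_eq_mul {j n : ℤ}
    (h : (n + 16) ^ 3 = j * n) : ∃ k ≤ 12, n = 2 ^ k ∨ n = -2 ^ k := by
  have hdvd : n ∣ 2 ^ 12 := ⟨j - n ^ 2 - 48 * n - 768, by linear_combination h⟩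
  obtain ⟨k, hk, hassoc⟩ := (dvd_prime_pow Int.prime_two 12).mp hdvd
  exact ⟨k, hk, Int.associated_iff.mp hassoc⟩

/-- The set of integral `j`-invariants of rational points of `Y₀(2)`:
integers of the form `(t+16)³/t` for a nonzero rational `t`. -/
theorem stmt_2 :
    {j : ℤ | ∃ t : ℚ, t ≠ 0 ∧ (j : ℚ) = (t + 16) ^ 3 / t} =
      ({-(3^3*5^3), -(2^2*7^3), -(2^4*3^3), -(2^6), 0, 2^7, 2^6*3^3, 2^4*5^3, 2^11,
        2^2*3^6, 2^7*3^3, 17^3, 2^6*5^3, 2^5*7^3, 2^5*3^6, 2^4*3^3*5^3, 2^4*17^3,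
        2^3*31^3, 2^3*3^3*11^3, 2^2*3^6*7^3, 2^2*5^3*13^3, 2*127^3, 2*3^3*43^3,
        3^3*5^3*17^3, 257^3} : Set ℤ) := by
  ext j
  simp only [Set.mem_ofPred_eq, Set.mem_insert_iff, Set.mem_singleton_iff]
  constructor
  · rintro ⟨t, ht, hj⟩
    rw [eq_div_iff ht] at hj
    obtain ⟨n, rfl⟩ := exists_int_eq_of_add_pow_three_eq_mul hj.symm
    have hn : (n + 16) ^ 3 = j * n := by exact_mod_cast hj.symm
    obtain ⟨k, hk, rfl | rfl⟩ := exists_eq_or_eq_neg_two_pow_of_add_pow_three_eq_mul hn <;>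
      clear hj ht <;> interval_cases k <;> norm_num at hn ⊢ <;> omega
  · rintro (rfl | rfl | rfl | rfl | rfl | rfl | rfl | rfl | rfl | rfl | rfl | rfl | rfl |
      rfl | rfl | rfl | rfl | rfl | rfl | rfl | rfl | rfl | rfl | rfl | rfl)
    · exact ⟨-1, by norm_num, by norm_num⟩
    · exact ⟨-2, by norm_num, by norm_num⟩
    · exact ⟨-4, by norm_num, by norm_num⟩
    · exact ⟨-8, by norm_num, by norm_num⟩
    · exact ⟨-16, by norm_num, by norm_num⟩
    · exact ⟨-32, by norm_num, by norm_num⟩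
    · exact ⟨8, by norm_num, by norm_num⟩
    · exact ⟨4, by norm_num, by norm_num⟩
    · exact ⟨16, by norm_num, by norm_num⟩
    · exact ⟨2, by norm_num, by norm_num⟩
    · exact ⟨32, by norm_num, by norm_num⟩
    · exact ⟨1, by norm_num, by norm_num⟩
    · exact ⟨64, by norm_num, by norm_num⟩
    · exact ⟨-128, by norm_num, by norm_num⟩
    · exact ⟨128, by norm_num, by norm_num⟩
    · exact ⟨-256, by norm_num, by norm_num⟩
    · exact ⟨256, by norm_num, by norm_num⟩
    · exact ⟨-512, by norm_num, by norm_num⟩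
    · exact ⟨512, by norm_num, by norm_num⟩
    · exact ⟨-1024, by norm_num, by norm_num⟩
    · exact ⟨1024, by norm_num, by norm_num⟩
    · exact ⟨-2048, by norm_num, by norm_num⟩
    · exact ⟨2048, by norm_num, by norm_num⟩
    · exact ⟨-4096, by norm_num, by norm_num⟩
    · exact ⟨4096, by norm_num, by norm_num⟩
end

section
/- The set of integers j for which there exists a nonzero rational number t with j = (t+27)(t+3)³/t is exactly {−2⁴·11⁶·13, −2¹⁵·3·5³, −2⁴·3²·13³, −2⁴·13, 0, 2⁴·3³, 2⁸·7, 2⁴·3³·5, 2⁸·3³, 2⁴·3³·5³, 2⁸·3²·7³, 2⁴·3·5·41³, 2⁸·7·61³}. -/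
open Polynomial in
/-- A rational `t` at which `(t+27)(t+3)³/t` is integral is an integer dividing `3⁶`. -/
theorem exists_int_dvd_of_j_integral {j : ℤ} {t : ℚ} (ht : t ≠ 0)
    (h : (j : ℚ) = (t + 27) * (t + 3) ^ 3 / t) : ∃ n : ℤ, (n : ℚ) = t ∧ n ∣ 729 := by
  rw [eq_div_iff ht] at h
  have hint : IsIntegral ℤ t := by
    refine ⟨X ^ 4 + C 36 * X ^ 3 + C 270 * X ^ 2 + C (756 - j) * X + C 729, by monicity!, ?_⟩
    simp only [eval₂_add, eval₂_mul, eval₂_pow, eval₂_X, eval₂_C]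
    simp only [eq_intCast]
    push_cast
    linear_combination -h
  obtain ⟨n, rfl⟩ := IsIntegrallyClosed.isIntegral_iff.mp hint
  rw [eq_intCast] at h
  refine ⟨n, rfl, j - n ^ 3 - 36 * n ^ 2 - 270 * n - 756, ?_⟩
  have h' : j * n = (n + 27) * (n + 3) ^ 3 := by exact_mod_cast h
  linear_combination -h'

/-- The set of integral `j`-invariants of rational points of `Y₀(3)`:
integers of the form `(t+27)(t+3)³/t` for a nonzero rational `t`. -/
theorem stmt_3 :
    {j : ℤ | ∃ t : ℚ, t ≠ 0 ∧ (j : ℚ) = (t + 27) * (t + 3) ^ 3 / t} =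
      ({-(2^4*11^6*13), -(2^15*3*5^3), -(2^4*3^2*13^3), -(2^4*13), 0, 2^4*3^3, 2^8*7,
        2^4*3^3*5, 2^8*3^3, 2^4*3^3*5^3, 2^8*3^2*7^3, 2^4*3*5*41^3, 2^8*7*61^3} : Set ℤ) := by
  ext j
  simp only [Set.mem_ofPred_eq, Set.mem_insert_iff, Set.mem_singleton_iff]
  constructor
  · rintro ⟨t, ht, h⟩
    obtain ⟨n, rfl, hn⟩ := exists_int_dvd_of_j_integral ht h
    rw [eq_div_iff ht] at h
    have h' : j * n = (n + 27) * (n + 3) ^ 3 := by exact_mod_cast h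
    have hk : n.natAbs ∣ 3 ^ 6 := Int.natAbs_dvd_natAbs.mpr hn
    obtain ⟨k, hk, hnk⟩ := (Nat.dvd_prime_pow Nat.prime_three).mp hk
    interval_cases k <;> rcases Int.natAbs_eq_iff.mp hnk with rfl | rfl <;>
      norm_num at h' ⊢ <;> omega
  · have key (n : ℤ) (hn : n ≠ 0) (h : j * n = (n + 27) * (n + 3) ^ 3) :
        ∃ t : ℚ, t ≠ 0 ∧ (j : ℚ) = (t + 27) * (t + 3) ^ 3 / t :=
      ⟨n, by exact_mod_cast hn, by
        rw [eq_div_iff (by exact_mod_cast hn)]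
        exact_mod_cast h⟩
    rintro (rfl | rfl | rfl | rfl | rfl | rfl | rfl | rfl | rfl | rfl | rfl | rfl | rfl)
    · exact key (-729) (by norm_num) (by norm_num)
    · exact key (-243) (by norm_num) (by norm_num)
    · exact key (-81) (by norm_num) (by norm_num)
    · exact key (-1) (by norm_num) (by norm_num)
    · exact key (-27) (by norm_num) (by norm_num)
    · exact key (-9) (by norm_num) (by norm_num)
    · exact key 1 (by norm_num) (by norm_num)
    · exact key 3 (by norm_num) (by norm_num)
    · exact key 9 (by norm_num) (by norm_num)
    · exact key 27 (by norm_num) (by norm_num)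
    · exact key 81 (by norm_num) (by norm_num)
    · exact key 243 (by norm_num) (by norm_num)
    · exact key 729 (by norm_num) (by norm_num)
end

section
/- The set of integers j for which there exists a nonzero rational number t with j = (t²+10t+5)³/t is exactly {−2⁶·719³, −2⁶·5·19³, 2⁶, 2⁶·5², 2¹², 2¹²·5², 2¹²·5·11³, 2¹²·211³}. -/
/-- A rational number `t` with `(t² + 10t + 5)³ = j t` for an integer `j` is an integer. -/
theorem exists_int_eq_of_cube_eq_mul (j : ℤ) (t : ℚ)
    (h : (t ^ 2 + 10 * t + 5) ^ 3 = j * t) : ∃ n : ℤ, (n : ℚ) = t := by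
  have hint : IsIntegral ℤ t := by
    refine ⟨(Polynomial.X ^ 2 + Polynomial.C 10 * Polynomial.X + Polynomial.C 5) ^ 3
      - Polynomial.C j * Polynomial.X, by monicity!, ?_⟩
    simp [h, Polynomial.eval₂_pow, Polynomial.eval₂_add, Polynomial.eval₂_sub,
      - algebraMap_int_eq, ← Polynomial.aeval_def]
  exact IsIntegrallyClosed.isIntegral_iff.mp hint

/-- The integral divisors of `125`. -/
theorem eq_of_dvd_five_cubed {n : ℤ} (h : n ∣ 5 ^ 3) :
    n = 1 ∨ n = 5 ∨ n = 25 ∨ n = 125 ∨ n = -1 ∨ n = -5 ∨ n = -25 ∨ n = -125 := by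
  obtain ⟨k, hk, hn⟩ := (Nat.dvd_prime_pow Nat.prime_five).mp
    (show n.natAbs ∣ 5 ^ 3 by simpa using Int.natAbs_dvd_natAbs.mpr h)
  interval_cases k <;> omega

/-- The set of integral `j`-invariants of rational points of `Y₀(5)`:
integers of the form `(t²+10t+5)³/t` for a nonzero rational `t`. -/
theorem stmt_4 :
    {j : ℤ | ∃ t : ℚ, t ≠ 0 ∧ (j : ℚ) = (t ^ 2 + 10 * t + 5) ^ 3 / t} =
      ({-(2^6*719^3), -(2^6*5*19^3), 2^6, 2^6*5^2, 2^12, 2^12*5^2, 2^12*5*11^3,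
        2^12*211^3} : Set ℤ) := by
  ext j
  simp only [Set.mem_ofPred_eq, Set.mem_insert_iff, Set.mem_singleton_iff]
  constructor
  · rintro ⟨t, ht, h⟩
    rw [eq_div_iff ht] at h
    obtain ⟨n, rfl⟩ := exists_int_eq_of_cube_eq_mul j t h.symm
    have hj : j * n = (n ^ 2 + 10 * n + 5) ^ 3 := by exact_mod_cast h
    have hdvd : n ∣ 5 ^ 3 := by
      refine ⟨j - (n + 10) * ((n ^ 2 + 10 * n + 5) ^ 2 + (n ^ 2 + 10 * n + 5) * 5 + 5 ^ 2), ?_⟩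
      linear_combination -hj
    rcases eq_of_dvd_five_cubed hdvd with rfl | rfl | rfl | rfl | rfl | rfl | rfl | rfl <;>
      omega
  · rintro (rfl | rfl | rfl | rfl | rfl | rfl | rfl | rfl)
    · exact ⟨-125, by norm_num, by norm_num⟩
    · exact ⟨-25, by norm_num, by norm_num⟩
    · exact ⟨-1, by norm_num, by norm_num⟩
    · exact ⟨-5, by norm_num, by norm_num⟩
    · exact ⟨1, by norm_num, by norm_num⟩
    · exact ⟨5, by norm_num, by norm_num⟩
    · exact ⟨25, by norm_num, by norm_num⟩
    · exact ⟨125, by norm_num, by norm_num⟩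
end

section
/- The set of integers j for which there exists a nonzero rational number t with j = (t²+5t+1)³(t²+13t+49)/t is exactly {−3³·37·719³, −3³·5³, 3³·37, 3²·7⁴, 3³·5³·17³, 3²·7·2647³}. -/
open Polynomial in
/-- A rational `t` for which `(t²+5t+1)³(t²+13t+49)/t` is an integer is itself an integer. -/
theorem exists_int_eq_of_modular_j_eq_int {j : ℤ} {t : ℚ} (ht : t ≠ 0)
    (h : (j : ℚ) = (t ^ 2 + 5 * t + 1) ^ 3 * (t ^ 2 + 13 * t + 49) / t) :
    ∃ n : ℤ, (n : ℚ) = t := by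
  have hint : IsIntegral ℤ t := by
    refine ⟨(X ^ 2 + 5 * X + 1) ^ 3 * (X ^ 2 + 13 * X + 49) - C j * X, ?_, ?_⟩
    · have h₁ : (X ^ 2 + 5 * X + 1 : ℤ[X]).Monic := by monicity!
      have h₂ : (X ^ 2 + 13 * X + 49 : ℤ[X]).Monic := by monicity!
      refine ((h₁.pow 3).mul h₂).sub_of_left ((degree_C_mul_X_le j).trans_lt ?_)
      have d₁ : (X ^ 2 + 5 * X + 1 : ℤ[X]).degree = 2 := by compute_degree!
      have d₂ : (X ^ 2 + 13 * X + 49 : ℤ[X]).degree = 2 := by compute_degree!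
      rw [degree_mul, degree_pow, d₁, d₂]
      decide
    · rw [eq_div_iff ht] at h
      rw [← aeval_def]
      simp [h, map_ofNat (aeval t)]
  exact IsIntegrallyClosed.isIntegral_iff.mp hint

/-- An integer `n` satisfying `j n = (n²+5n+1)³(n²+13n+49)` divides the constant term `49`. -/
theorem dvd_forty_nine_of_mul_eq {j n : ℤ}
    (h : j * n = (n ^ 2 + 5 * n + 1) ^ 3 * (n ^ 2 + 13 * n + 49)) : n ∣ 49 := by
  refine (Int.modEq_zero_iff_dvd).mp ?_
  have hn : n ≡ 0 [ZMOD n] := by simp [Int.ModEq]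
  calc (49 : ℤ) = (0 ^ 2 + 5 * 0 + 1) ^ 3 * (0 ^ 2 + 13 * 0 + 49) := by norm_num
    _ ≡ (n ^ 2 + 5 * n + 1) ^ 3 * (n ^ 2 + 13 * n + 49) [ZMOD n] := by gcongr
    _ = j * n := h.symm
    _ ≡ 0 [ZMOD n] := by simp [Int.ModEq]

/-- The set of integral `j`-invariants of rational points of `Y₀(7)`:
integers of the form `(t²+5t+1)³(t²+13t+49)/t` for a nonzero rational `t`. -/
theorem stmt_5 :
    {j : ℤ | ∃ t : ℚ, t ≠ 0 ∧
      (j : ℚ) = (t ^ 2 + 5 * t + 1) ^ 3 * (t ^ 2 + 13 * t + 49) / t} =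
      ({-(3^3*37*719^3), -(3^3*5^3), 3^3*37, 3^2*7^4, 3^3*5^3*17^3, 3^2*7*2647^3} : Set ℤ) := by
  ext j
  simp only [Set.mem_ofPred_eq, Set.mem_insert_iff, Set.mem_singleton_iff]
  constructor
  · rintro ⟨t, ht, h⟩
    obtain ⟨n, rfl⟩ := exists_int_eq_of_modular_j_eq_int ht h
    rw [eq_div_iff ht] at h
    norm_cast at h
    have hd := dvd_forty_nine_of_mul_eq h
    have hmem : n.natAbs ∈ ({1, 7, 49} : Finset ℕ) := by
      rw [show ({1, 7, 49} : Finset ℕ) = Nat.divisors 49 by decide, Nat.mem_divisors]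
      exact ⟨Int.natAbs_dvd_natAbs.mpr hd, by norm_num⟩
    simp only [Finset.mem_insert, Finset.mem_singleton] at hmem
    have hn : n = 1 ∨ n = -1 ∨ n = 7 ∨ n = -7 ∨ n = 49 ∨ n = -49 := by omega
    rcases hn with rfl | rfl | rfl | rfl | rfl | rfl <;> omega
  · rintro (rfl | rfl | rfl | rfl | rfl | rfl)
    · exact ⟨-49, by norm_num, by norm_num⟩
    · exact ⟨-7, by norm_num, by norm_num⟩
    · exact ⟨-1, by norm_num, by norm_num⟩
    · exact ⟨1, by norm_num, by norm_num⟩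
    · exact ⟨7, by norm_num, by norm_num⟩
    · exact ⟨49, by norm_num, by norm_num⟩
end

section
/- The set of integers j for which there exists a nonzero rational number t with j = (t⁴+7t³+20t²+19t+1)³(t²+5t+13)/t is exactly {−2⁶·3²·4079³, 2⁶·3², 2¹²·3³·19, 2¹²·3³·19·991³}. -/
/-- A rational `t` whose value under the `j`-map of `X₀(13)` is an integer is itself an integer
dividing `13`. -/
theorem exists_int_dvd_thirteen_of_j_eq {j : ℤ} {t : ℚ} (ht : t ≠ 0)
    (h : (j : ℚ) = (t ^ 4 + 7 * t ^ 3 + 20 * t ^ 2 + 19 * t + 1) ^ 3 *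
      (t ^ 2 + 5 * t + 13) / t) :
    ∃ n : ℤ, t = n ∧ n ∣ 13 := by
  obtain ⟨a, b, hb, hab, rfl⟩ : ∃ a b : ℤ, b ≠ 0 ∧ IsCoprime b a ∧ t = a / b :=
    ⟨t.num, t.den, by exact_mod_cast t.den_nz,
      (Rat.isCoprime_num_den t).symm, by exact_mod_cast (Rat.num_div_den t).symm⟩
  have hbQ : (b : ℚ) ≠ 0 := by exact_mod_cast hb
  have key : a * (j * b ^ 13) =
      (a ^ 4 + b * (7 * a ^ 3 + 20 * a ^ 2 * b + 19 * a * b ^ 2 + b ^ 3)) ^ 3 *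
        (a ^ 2 + b * (5 * a + 13 * b)) := by
    rw [eq_div_iff ht] at h
    field_simp at h
    have h' : (a : ℚ) * (j * b ^ 13) =
        (a ^ 4 + b * (7 * a ^ 3 + 20 * a ^ 2 * b + 19 * a * b ^ 2 + b ^ 3)) ^ 3 *
          (a ^ 2 + b * (5 * a + 13 * b)) := by
      linear_combination h
    exact_mod_cast h'
  have hdvd : b ∣ a ^ 14 := by
    generalize 7 * a ^ 3 + 20 * a ^ 2 * b + 19 * a * b ^ 2 + b ^ 3 = u at key
    generalize 5 * a + 13 * b = v at key
    refine ⟨a * j * b ^ 12 - v * (a ^ 4 + b * u) ^ 3 -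
      a ^ 2 * (3 * a ^ 8 * u + 3 * a ^ 4 * b * u ^ 2 + b ^ 2 * u ^ 3), ?_⟩
    linear_combination -key
  have hunit : IsUnit b := (hab.pow_right (n := 14)).isUnit_of_dvd' dvd_rfl hdvd
  have hdvd' : a ∣ 13 * b ^ 14 := by
    have h1 : a ∣ (a * (a ^ 3 + 7 * a ^ 2 * b + 20 * a * b ^ 2 + 19 * b ^ 3) + b ^ 4) ^ 3 *
        (a * (a + 5 * b) + 13 * b ^ 2) :=
      ⟨j * b ^ 13, by linear_combination -key⟩
    generalize a ^ 3 + 7 * a ^ 2 * b + 20 * a * b ^ 2 + 19 * b ^ 3 = u at h1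
    generalize a + 5 * b = v at h1
    obtain ⟨c, hc⟩ := h1
    refine ⟨c - v * (a * u + b ^ 4) ^ 3 -
      13 * b ^ 2 * (a ^ 2 * u ^ 3 + 3 * a * u ^ 2 * b ^ 4 + 3 * u * b ^ 8), ?_⟩
    linear_combination hc
  rcases Int.isUnit_iff.mp hunit with rfl | rfl
  · exact ⟨a, by simp, by simpa using hdvd'⟩
  · exact ⟨-a, by simp [div_neg], by simpa using hdvd'⟩

/-- The set of integral `j`-invariants of rational points of `Y₀(13)`:
integers of the form `(t⁴+7t³+20t²+19t+1)³(t²+5t+13)/t` for a nonzero rational `t`. -/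
theorem stmt_6 :
    {j : ℤ | ∃ t : ℚ, t ≠ 0 ∧
      (j : ℚ) = (t ^ 4 + 7 * t ^ 3 + 20 * t ^ 2 + 19 * t + 1) ^ 3 *
        (t ^ 2 + 5 * t + 13) / t} =
      ({-(2^6*3^2*4079^3), 2^6*3^2, 2^12*3^3*19, 2^12*3^3*19*991^3} : Set ℤ) := by
  ext j
  simp only [Set.mem_ofPred_eq, Set.mem_insert_iff, Set.mem_singleton_iff]
  constructor
  · rintro ⟨t, ht, h⟩
    obtain ⟨n, rfl, hn⟩ := exists_int_dvd_thirteen_of_j_eq ht h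
    have hn' : n = 1 ∨ n = -1 ∨ n = 13 ∨ n = -13 := by
      have hp : Nat.Prime 13 := by norm_num
      have := (Nat.dvd_prime hp).mp (Int.natAbs_dvd_natAbs.mpr hn)
      omega
    rcases hn' with rfl | rfl | rfl | rfl <;> norm_num at h ⊢ <;> norm_cast at h <;> omega
  · rintro (rfl | rfl | rfl | rfl)
    · exact ⟨-13, by norm_num, by norm_num⟩
    · exact ⟨-1, by norm_num, by norm_num⟩
    · exact ⟨1, by norm_num, by norm_num⟩
    · exact ⟨13, by norm_num, by norm_num⟩
end

section
/- Let p be an odd prime and let ε ∈ 𝔽_p be a non-square. Let N_ε be the normaliser in GL₂(𝔽_p) of the nonsplit Cartan subgroup C_ε. If h ∈ N_ε and the characteristic polynomial of h splits over 𝔽_p as (X − c)(X − d) with c, d ∈ 𝔽_p, then c = d or c = −d. -/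
/-- The (explicit) nonsplit Cartan subgroup of `GL₂(𝔽_p)` attached to a non-square `ε`,
as a set: the invertible matrices of the form `!![x, ε*y; y, x]` with `(x, y) ≠ (0, 0)`. -/
def nonsplitCartan (p : ℕ) (ε : ZMod p) : Set (GL (Fin 2) (ZMod p)) :=
  {g | ∃ x y : ZMod p, ¬(x = 0 ∧ y = 0) ∧
    (g : Matrix (Fin 2) (Fin 2) (ZMod p)) = !![x, ε * y; y, x]}

/-- The normaliser of the nonsplit Cartan subgroup in `GL₂(𝔽_p)`. -/
def nonsplitCartanNormalizer (p : ℕ) (ε : ZMod p) : Set (GL (Fin 2) (ZMod p)) :=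
  {h | ∀ g : GL (Fin 2) (ZMod p), h * g * h⁻¹ ∈ nonsplitCartan p ε ↔ g ∈ nonsplitCartan p ε}

/-- Conjugation by an element of the normaliser of the nonsplit Cartan subgroup sends
`!![0, ε; 1, 0]` to itself or to its negative. -/
theorem exists_mul_eq_of_mem_nonsplitCartanNormalizer {p : ℕ} [Fact p.Prime]
    (h2 : (2 : ZMod p) ≠ 0) {ε : ZMod p} (hε : ε ≠ 0) {h : GL (Fin 2) (ZMod p)}
    (hh : h ∈ nonsplitCartanNormalizer p ε) :
    ∃ y : ZMod p, (y = 1 ∨ y = -1) ∧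
      (h : Matrix (Fin 2) (Fin 2) (ZMod p)) * !![0, ε; 1, 0] =
        !![0, ε * y; y, 0] * (h : Matrix (Fin 2) (Fin 2) (ZMod p)) := by
  have hdet : (!![0, ε; 1, 0] : Matrix (Fin 2) (Fin 2) (ZMod p)).det ≠ 0 := by
    simpa [Matrix.det_fin_two] using hε
  let g := Matrix.GeneralLinearGroup.mkOfDetNeZero !![0, ε; 1, 0] hdet
  have hg : (g : Matrix (Fin 2) (Fin 2) (ZMod p)) = !![0, ε; 1, 0] := rfl
  obtain ⟨x, y, -, hxy⟩ := (hh g).2 ⟨0, 1, by simp, by simp [hg]⟩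
  have htrace := congrArg Matrix.trace hxy
  have hdet' := congrArg Matrix.det hxy
  simp only [Units.val_mul] at htrace hdet'
  rw [Matrix.trace_units_conj, hg] at htrace
  rw [Matrix.det_units_conj, hg] at hdet'
  simp only [Matrix.trace_fin_two_of, Matrix.det_fin_two_of] at htrace hdet'
  obtain rfl : x = 0 := (mul_eq_zero.mp (by linear_combination -htrace : 2 * x = 0)).resolve_left h2
  refine ⟨y, mul_self_eq_one_iff.mp ?_, ?_⟩
  · exact mul_left_cancel₀ hε (by linear_combination hdet')
  · rw [← hxy, ← hg, ← Units.val_mul, ← Units.val_mul, inv_mul_cancel_right]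

/-- If `h` lies in the normaliser of the nonsplit Cartan subgroup and the characteristic
polynomial of `h` splits over `𝔽_p` as `(X - c)(X - d)`, then `c = d` or `c = -d`. -/
theorem stmt_8 (p : ℕ) (hp : p.Prime) (hodd : Odd p) (ε : ZMod p) (hε : ¬ IsSquare ε)
    (h : GL (Fin 2) (ZMod p)) (hh : h ∈ nonsplitCartanNormalizer p ε) (c d : ZMod p)
    (hcd : Matrix.charpoly (h : Matrix (Fin 2) (Fin 2) (ZMod p)) =
      (Polynomial.X - Polynomial.C c) * (Polynomial.X - Polynomial.C d)) :
    c = d ∨ c = -d := by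
  have : Fact p.Prime := ⟨hp⟩
  have h2 : (2 : ZMod p) ≠ 0 := by
    have : Fact (2 < p) := ⟨hp.two_le.lt_of_ne fun e => absurd (e ▸ hodd) (by decide)⟩
    exact Ring.two_ne_zero (by simpa [ZMod.ringChar_zmod_n] using this.out.ne')
  have hε0 : ε ≠ 0 := fun e => hε (e ▸ IsSquare.zero)
  obtain ⟨y, hy, hcomm⟩ := exists_mul_eq_of_mem_nonsplitCartanNormalizer h2 hε0 hh
  set M := (h : Matrix (Fin 2) (Fin 2) (ZMod p))
  rw [Matrix.charpoly_fin_two, Matrix.trace_fin_two, Matrix.det_fin_two] at hcd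
  have hprod := congrArg (Polynomial.eval 0) hcd
  have hsum := congrArg (Polynomial.eval 1) hcd
  simp only [Polynomial.eval_add, Polynomial.eval_sub, Polynomial.eval_mul, Polynomial.eval_pow,
    Polynomial.eval_X, Polynomial.eval_C] at hprod hsum
  have h10 := congrFun (congrFun hcomm 1) 0
  have h00 := congrFun (congrFun hcomm 0) 0
  simp [Matrix.mul_apply] at h10 h00
  rcases hy with rfl | rfl
  · left
    by_contra hne
    have hsq : (c - d) ^ 2 = ε * (2 * M 1 0) ^ 2 := by grind
    have h0 : 2 * M 1 0 ≠ 0 := by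
      intro h0
      rw [h0] at hsq
      exact hne (sub_eq_zero.mp (by simpa using hsq))
    exact hε ⟨(c - d) / (2 * M 1 0), by
      rw [div_mul_div_comm, eq_div_iff (mul_ne_zero h0 h0)]; linear_combination -hsq⟩
  · right
    linear_combination hsum - hprod + h10
end

section
/- Let p be an odd prime and let ε ∈ 𝔽_p be a non-square. Let N_ε be the normaliser in GL₂(𝔽_p) of the nonsplit Cartan subgroup C_ε, let B⁺ ≤ GL₂(𝔽_p) be the subgroup of invertible upper triangular matrices, and let B⁻ ≤ GL₂(𝔽_p) be the subgroup of invertible lower triangular matrices. Then N_ε · B⁺ = GL₂(𝔽_p) and N_ε · B⁻ = GL₂(𝔽_p); that is, every g ∈ GL₂(𝔽_p) can be written as g = n·b with n ∈ N_ε and b ∈ B⁺, and also as g = n'·b' with n' ∈ N_ε and b' ∈ B⁻. -/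
theorem commute_of_mem_nonsplitCartan {p : ℕ} {ε : ZMod p} {g h : GL (Fin 2) (ZMod p)}
    (hg : g ∈ nonsplitCartan p ε) (hh : h ∈ nonsplitCartan p ε) : Commute g h := by
  obtain ⟨x, y, -, hg⟩ := hg
  obtain ⟨z, w, -, hh⟩ := hh
  apply Units.ext
  ext i j
  fin_cases i <;> fin_cases j <;> simp [hg, hh, Matrix.mul_apply, Fin.sum_univ_two] <;> ring

theorem nonsplitCartan_subset_normalizer (p : ℕ) (ε : ZMod p) :
    nonsplitCartan p ε ⊆ nonsplitCartanNormalizer p ε := by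
  intro h hh g
  constructor
  · intro hk
    have hc := commute_of_mem_nonsplitCartan hh hk
    have hg : h * g * h⁻¹ = g := mul_left_cancel (hc.eq.trans (inv_mul_cancel_right (h * g) h))
    rwa [hg] at hk
  · intro hg
    rwa [(commute_of_mem_nonsplitCartan hh hg).eq, mul_inv_cancel_right]

theorem sq_sub_mul_sq_ne_zero {F : Type*} [Field F] {ε x y : F} (hε : ¬IsSquare ε)
    (hxy : ¬(x = 0 ∧ y = 0)) : x ^ 2 - ε * y ^ 2 ≠ 0 := by
  intro h
  by_cases hy : y = 0
  · subst hy
    exact hxy ⟨by simpa using h, rfl⟩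
  · refine hε ⟨x / y, ?_⟩
    field_simp
    linear_combination -h

theorem exists_mem_nonsplitCartan {p : ℕ} [Fact p.Prime] {ε x y : ZMod p} (hε : ¬IsSquare ε)
    (hxy : ¬(x = 0 ∧ y = 0)) :
    ∃ n ∈ nonsplitCartan p ε, (n : Matrix (Fin 2) (Fin 2) (ZMod p)) = !![x, ε * y; y, x] := by
  have hdet : (!![x, ε * y; y, x] : Matrix (Fin 2) (Fin 2) (ZMod p)).det ≠ 0 := by
    rw [Matrix.det_fin_two_of]
    convert sq_sub_mul_sq_ne_zero hε hxy using 1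
    ring
  exact ⟨Matrix.GeneralLinearGroup.mkOfDetNeZero _ hdet, ⟨x, y, hxy, rfl⟩, rfl⟩

/-- `N_ε · B⁺ = GL₂(𝔽_p)` and `N_ε · B⁻ = GL₂(𝔽_p)`: every `g ∈ GL₂(𝔽_p)` is a product
of an element of the normaliser of the nonsplit Cartan and an upper triangular matrix,
and likewise with a lower triangular matrix. -/
theorem stmt_11 (p : ℕ) (hp : p.Prime) (hodd : Odd p) (ε : ZMod p) (hε : ¬ IsSquare ε)
    (g : GL (Fin 2) (ZMod p)) :
    (∃ n ∈ nonsplitCartanNormalizer p ε, ∃ b : GL (Fin 2) (ZMod p),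
      (b : Matrix (Fin 2) (Fin 2) (ZMod p)) 1 0 = 0 ∧ g = n * b) ∧
    (∃ n ∈ nonsplitCartanNormalizer p ε, ∃ b : GL (Fin 2) (ZMod p),
      (b : Matrix (Fin 2) (Fin 2) (ZMod p)) 0 1 = 0 ∧ g = n * b) := by
  have : Fact p.Prime := ⟨hp⟩
  have hε0 : ε ≠ 0 := fun h => hε (h ▸ IsSquare.zero)
  have hdet : (g : Matrix (Fin 2) (Fin 2) (ZMod p)) 0 0 * g 1 1 - g 0 1 * g 1 0 ≠ 0 := by
    rw [← Matrix.det_fin_two]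
    exact g.det_ne_zero
  constructor
  · have hxy : ¬(g 0 0 = 0 ∧ g 1 0 = 0) := fun h => hdet (by simp [h.1, h.2])
    obtain ⟨n, hn, hnm⟩ := exists_mem_nonsplitCartan hε hxy
    refine ⟨n, nonsplitCartan_subset_normalizer p ε hn, n⁻¹ * g, ?_, (mul_inv_cancel_left n g).symm⟩
    generalize hb : n⁻¹ * g = b
    have hg : (g : Matrix (Fin 2) (Fin 2) (ZMod p)) = n * b := by simp [← hb]
    have h0 := congrFun₂ hg 0 0
    have h1 := congrFun₂ hg 1 0
    simp only [hnm, Matrix.mul_apply, Fin.sum_univ_two, Matrix.of_apply, Matrix.cons_val',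
      Matrix.cons_val_zero, Matrix.cons_val_one, Matrix.cons_val_fin_one] at h0 h1
    refine (mul_eq_zero.mp ?_).resolve_left (sq_sub_mul_sq_ne_zero hε hxy)
    linear_combination g 1 0 * h0 - g 0 0 * h1
  · have hxy : ¬(g 1 1 = 0 ∧ g 0 1 / ε = 0) := fun h =>
      hdet (by simp [h.1, (div_eq_zero_iff.mp h.2).resolve_right hε0])
    obtain ⟨n, hn, hnm⟩ := exists_mem_nonsplitCartan hε hxy
    refine ⟨n, nonsplitCartan_subset_normalizer p ε hn, n⁻¹ * g, ?_, (mul_inv_cancel_left n g).symm⟩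
    generalize hb : n⁻¹ * g = b
    have hg : (g : Matrix (Fin 2) (Fin 2) (ZMod p)) = n * b := by simp [← hb]
    have h0 := congrFun₂ hg 0 1
    have h1 := congrFun₂ hg 1 1
    have hy : ε * (g 0 1 / ε) = g 0 1 := mul_div_cancel₀ _ hε0
    simp only [hnm, Matrix.mul_apply, Fin.sum_univ_two, Matrix.of_apply, Matrix.cons_val',
      Matrix.cons_val_zero, Matrix.cons_val_one, Matrix.cons_val_fin_one] at h0 h1
    refine (mul_eq_zero.mp ?_).resolve_left (sq_sub_mul_sq_ne_zero hε hxy)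
    linear_combination ε * (g 0 1 / ε) * h1 - g 1 1 * h0 - g 1 1 * hy
end
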